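/- Let γ ∈ N be injective and let ε > 0. Then there exist m ≥ 3 and points v₀, v₁, …, v_{m−1} ∈ ℝ² (indices taken modulo m) such that: (i) consecutive vertices are distinct, and the closed polygonal curve with vertices v₀, …, v_{m−1} is simple (the closed segments [v_i, v_{i+1}] are pairwise disjoint except for consecutive segments meeting exactly at their common vertex); (ii) the perimeter Σ_{i=0}^{m−1} ‖v_{i+1} − v_i‖ equals 1; (iii) for every i, the angle between the unit edge directions e_{i−1} = (v_i − v_{i−1})/‖v_i − v_{i−1}‖ and e_i = (v_{i+1} − v_i)/‖v_{i+1} − v_i‖ is a rational multiple of π; (iv) d_H(K(γ), K(P)) < ε, where K(γ) = {(γ(t), ±γ'(t)) : t ∈ ℝ/ℤ}, K(P) = ⋃_{i=0}^{m−1} { (p, ±e_i) : p ∈ [v_i, v_{i+1}] }, and d_H is the Hausdorff distance on nonempty compact subsets of ℝ² × ℝ². -/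

import Mathlib

/-- `Γ`: the space of `C¹` loops `γ : ℝ/ℤ → ℝ²`, seen as 1-periodic `C¹` maps `ℝ → ℝ²`. -/
def InGamma (γ : ℝ → EuclideanSpace ℝ (Fin 2)) : Prop :=
  ContDiff ℝ 1 γ ∧ Function.Periodic γ 1

/-- `N`: the set of unit-speed parametrizations in `Γ`. -/
def InN (γ : ℝ → EuclideanSpace ℝ (Fin 2)) : Prop :=
  InGamma γ ∧ ∀ t : ℝ, ‖deriv γ t‖ = 1

/-- Injectivity of a 1-periodic loop as a map on the circle `ℝ/ℤ`. -/
def InjLoop (γ : ℝ → EuclideanSpace ℝ (Fin 2)) : Prop :=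
  ∀ s t : ℝ, γ s = γ t → ∃ k : ℤ, s - t = (k : ℝ)

/-- `K(γ) = {(γ(t), ±γ'(t))} ⊆ ℝ² × ℝ²`, the unitary tangent bundle of the image of `γ`. -/
def Kset (γ : ℝ → EuclideanSpace ℝ (Fin 2)) :
    Set (EuclideanSpace ℝ (Fin 2) × EuclideanSpace ℝ (Fin 2)) :=
  {p | ∃ t : ℝ, p = (γ t, deriv γ t)} ∪ {p | ∃ t : ℝ, p = (γ t, -deriv γ t)}

noncomputable def uvec (x : ℝ) : EuclideanSpace ℝ (Fin 2) := !₂[Real.cos x, Real.sin x]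

lemma uvec_norm (x : ℝ) : ‖uvec x‖ = 1 := by
  rw [EuclideanSpace.norm_eq]
  simp [uvec, Fin.sum_univ_two]

lemma uvec_inner (x y : ℝ) : inner ℝ (uvec x) (uvec y) = Real.cos (x - y) := by
  simp [uvec, PiLp.inner_apply, Fin.sum_univ_two, Real.cos_sub]
  ring

lemma uvec_angle (p q : ℚ) : ∃ r : ℚ,
    InnerProductGeometry.angle (uvec (p * Real.pi)) (uvec (q * Real.pi)) = (r : ℝ) * Real.pi := by
  unfold InnerProductGeometry.angle
  rw [uvec_inner, uvec_norm, uvec_norm]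
  have h : Real.cos (Real.arccos (Real.cos (p * Real.pi - q * Real.pi)))
      = Real.cos (p * Real.pi - q * Real.pi) :=
    Real.cos_arccos (Real.neg_one_le_cos _) (Real.cos_le_one _)
  obtain ⟨k, hk | hk⟩ := Real.cos_eq_cos_iff.1 h
  · refine ⟨(p - q) - 2 * k, ?_⟩
    simp only [mul_one, div_one]
    push_cast
    linarith
  · refine ⟨2 * k - (p - q), ?_⟩
    simp only [mul_one, div_one]
    push_cast
    linarith

lemma uvec_dist (x y : ℝ) : ‖uvec x - uvec y‖ ≤ |x - y| := by
  have h1 : ‖uvec x - uvec y‖ ^ 2 ≤ |x - y| ^ 2 := by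
    rw [@norm_sub_sq_real, uvec_inner, uvec_norm, uvec_norm, sq_abs]
    have := Real.one_sub_sq_div_two_le_cos (x := x - y)
    linarith
  exact le_of_sq_le_sq h1 (abs_nonneg _)

lemma decomp (κ : ℝ) (hκ : 0 < κ) (w : EuclideanSpace ℝ (Fin 2)) (hw : w ≠ 0) :
    ∃ (a b : ℝ) (p q : ℚ), 0 < a ∧ 0 < b ∧
      w = a • uvec (p * Real.pi) + b • uvec (q * Real.pi) ∧
      ‖uvec (p * Real.pi) - uvec (q * Real.pi)‖ ≤ κ := by
  obtain ⟨r, φ, hr, h0, h1⟩ : ∃ r φ : ℝ, 0 < r ∧ w 0 = r * Real.cos φ ∧ w 1 = r * Real.sin φ := by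
    refine ⟨‖(⟨w 0, w 1⟩ : ℂ)‖, Complex.arg ⟨w 0, w 1⟩, ?_, ?_, ?_⟩
    · rw [norm_pos_iff]
      intro h
      apply hw
      have h2 := congrArg Complex.re h
      have h3 := congrArg Complex.im h
      ext i
      fin_cases i
      · simpa using h2
      · simpa using h3
    · rw [Complex.norm_mul_cos_arg]
    · rw [Complex.norm_mul_sin_arg]
  have hpi := Real.pi_pos
  set d := min (κ / 2) 1 with hd
  have hd0 : 0 < d := by positivity
  have hd1 : d ≤ 1 := min_le_right _ _
  have hd2 : d ≤ κ / 2 := min_le_left _ _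
  obtain ⟨p, hp1, hp2⟩ := exists_rat_btwn (show (φ - d) / Real.pi < φ / Real.pi by
    gcongr; linarith)
  obtain ⟨q, hq1, hq2⟩ := exists_rat_btwn (show φ / Real.pi < (φ + d) / Real.pi by
    gcongr; linarith)
  rw [div_lt_iff₀ hpi] at hp1 hq1
  rw [lt_div_iff₀ hpi] at hp2 hq2
  have h3 := Real.pi_gt_three
  generalize hP : (p : ℝ) * Real.pi = P at *
  generalize hQ : (q : ℝ) * Real.pi = Q at *
  have hs : 0 < Real.sin (Q - P) := Real.sin_pos_of_pos_of_lt_pi (by linarith) (by linarith)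
  refine ⟨r * Real.sin (Q - φ) / Real.sin (Q - P), r * Real.sin (φ - P) / Real.sin (Q - P),
    p, q, ?_, ?_, ?_, ?_⟩
  · have := Real.sin_pos_of_pos_of_lt_pi (x := Q - φ) (by linarith) (by linarith)
    positivity
  · have := Real.sin_pos_of_pos_of_lt_pi (x := φ - P) (by linarith) (by linarith)
    positivity
  · rw [hP, hQ]
    ext i
    fin_cases i
    · simp [uvec, h0]
      field_simp
      simp only [Real.sin_sub]
      ring
    · simp [uvec, h1]
      field_simp
      simp only [Real.sin_sub]
      ring
  · rw [hP, hQ]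
    refine (uvec_dist _ _).trans ?_
    rw [abs_le]
    constructor <;> linarith

lemma deriv_per {γ : ℝ → EuclideanSpace ℝ (Fin 2)} (hγ : InN γ) :
    Function.Periodic (deriv γ) 1 := by
  intro t
  have h : (fun x => γ (x + 1)) = γ := funext hγ.1.2
  rw [← deriv_comp_add_const, h]

lemma deriv_cont {γ : ℝ → EuclideanSpace ℝ (Fin 2)} (hγ : InN γ) : Continuous (deriv γ) :=
  hγ.1.1.continuous_deriv le_rfl

lemma deriv_unif {γ : ℝ → EuclideanSpace ℝ (Fin 2)} (hγ : InN γ) (η : ℝ) (hη : 0 < η) :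
    ∃ δ > 0, ∀ s t : ℝ, |t - s| ≤ δ → ‖deriv γ t - deriv γ s‖ ≤ η := by
  have hc : UniformContinuousOn (deriv γ) (Set.Icc (-1) 2) :=
    isCompact_Icc.uniformContinuousOn_of_continuous (deriv_cont hγ).continuousOn
  rw [Metric.uniformContinuousOn_iff] at hc
  obtain ⟨δ, hδ, h⟩ := hc η hη
  refine ⟨min (δ / 2) 1, by positivity, ?_⟩
  intro s t hst
  have h1 : |t - s| ≤ δ / 2 := hst.trans (min_le_left _ _)
  have h2 : |t - s| ≤ 1 := hst.trans (min_le_right _ _)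
  have e1 : deriv γ s = deriv γ (s - ⌊s⌋) := by
    simpa using ((deriv_per hγ).sub_int_mul_eq (x := s) ⌊s⌋).symm
  have e2 : deriv γ t = deriv γ (t - ⌊s⌋) := by
    simpa using ((deriv_per hγ).sub_int_mul_eq (x := t) ⌊s⌋).symm
  have f1 := Int.floor_le s
  have f2 := Int.lt_floor_add_one s
  rw [abs_le] at h2
  rw [e1, e2, ← dist_eq_norm]
  apply le_of_lt
  apply h
  · constructor <;> linarith
  · constructor <;> linarith
  · rw [Real.dist_eq]
    ring_nf
    ring_nf at h1
    linarith

lemma mvt {γ : ℝ → EuclideanSpace ℝ (Fin 2)} (hγ : InN γ) (A : EuclideanSpace ℝ (Fin 2))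
    (η x y : ℝ) (hxy : x ≤ y) (h : ∀ t ∈ Set.Icc x y, ‖A - deriv γ t‖ ≤ η) :
    ‖((y - x) • A - (γ y - γ x))‖ ≤ η * (y - x) := by
  have hd : ∀ t, HasDerivAt (fun t => t • A - γ t) (A - deriv γ t) t := by
    intro t
    have h1 := (hasDerivAt_id t).smul_const A
    have h2 := ((hγ.1.1.differentiable (by norm_num)) t).hasDerivAt
    have h3 := h1.sub h2
    rw [one_smul] at h3
    exact h3
  have := Convex.norm_image_sub_le_of_norm_hasDerivWithin_le (s := Set.Icc x y)
    (fun t _ => (hd t).hasDerivWithinAt) h (convex_Icc x y)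
    (Set.left_mem_Icc.2 hxy) (Set.right_mem_Icc.2 hxy)
  rw [Real.norm_of_nonneg (by linarith)] at this
  have e : (y - x) • A - (γ y - γ x) = (y • A - γ y) - (x • A - γ x) := by module
  rw [e]
  exact this

lemma bilip {γ : ℝ → EuclideanSpace ℝ (Fin 2)} (hγ : InN γ) (hinj : InjLoop γ) :
    ∃ c > 0, ∀ s t : ℝ, s ≤ t → t - s ≤ 1 / 2 → c * (t - s) ≤ ‖γ t - γ s‖ := by
  obtain ⟨δ, hδ, hu⟩ := deriv_unif hγ (1 / 2) (by norm_num)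
  have hloc : ∀ s t : ℝ, s ≤ t → t - s ≤ δ → 1 / 2 * (t - s) ≤ ‖γ t - γ s‖ := by
    intro s t hst h
    have h1 := mvt hγ (deriv γ s) (1 / 2) s t hst (by
      intro r hr
      apply hu
      rw [abs_le]
      constructor <;> linarith [hr.1, hr.2])
    have h2 : ‖(t - s) • deriv γ s‖ = t - s := by
      rw [norm_smul, hγ.2, Real.norm_of_nonneg (by linarith), mul_one]
    have h3 := norm_sub_norm_le ((t - s) • deriv γ s) (γ t - γ s)
    linarith
  have hcont : Continuous γ := hγ.1.1.continuous
  obtain ⟨c₀, hc₀, hfar⟩ : ∃ c₀ > 0, ∀ s ∈ Set.Icc (0 : ℝ) 1, ∀ d ∈ Set.Icc δ (1 / 2),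
      c₀ ≤ ‖γ (s + d) - γ s‖ := by
    have hK : IsCompact (Set.Icc (0 : ℝ) 1 ×ˢ Set.Icc δ (1 / 2)) := isCompact_Icc.prod isCompact_Icc
    rcases (Set.Icc (0 : ℝ) 1 ×ˢ Set.Icc δ (1 / 2)).eq_empty_or_nonempty with he | hne
    · refine ⟨1, one_pos, fun s hs d hd => ?_⟩
      have : (s, d) ∈ (Set.Icc (0 : ℝ) 1 ×ˢ Set.Icc δ (1 / 2)) := ⟨hs, hd⟩
      rw [he] at this
      exact this.elim
    · obtain ⟨z, hz, hmin⟩ := hK.exists_isMinOn hne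
        (f := fun z : ℝ × ℝ => ‖γ (z.1 + z.2) - γ z.1‖) (by fun_prop)
      refine ⟨_, ?_, fun s hs d hd => hmin (a := (s, d)) ⟨hs, hd⟩⟩
      rw [gt_iff_lt, norm_pos_iff, sub_ne_zero]
      intro h
      obtain ⟨k, hk⟩ := hinj _ _ h
      have h1 := hz.2.1
      have h2 := hz.2.2
      have h3 : (0 : ℝ) < k := by linarith
      have h4 : (k : ℝ) < 1 := by linarith
      norm_cast at h3 h4
      omega
  refine ⟨min (1 / 2) c₀, by positivity, fun s t hst h => ?_⟩
  rcases le_total (t - s) δ with h1 | h1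
  · refine le_trans ?_ (hloc s t hst h1)
    exact mul_le_mul_of_nonneg_right (min_le_left _ _) (by linarith)
  · have h2 := hfar (s - ⌊s⌋) ⟨by linarith [Int.floor_le s], by linarith [Int.lt_floor_add_one s]⟩
      (t - s) ⟨h1, h⟩
    have e1 : γ s = γ (s - ⌊s⌋) := by
      simpa using (hγ.1.2.sub_int_mul_eq (x := s) ⌊s⌋).symm
    have e2 : γ t = γ (s - ⌊s⌋ + (t - s)) := by
      have : s - ⌊s⌋ + (t - s) = t - ⌊s⌋ := by ring
      rw [this]
      simpa using (hγ.1.2.sub_int_mul_eq (x := t) ⌊s⌋).symm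
    rw [e1, e2]
    refine le_trans ?_ h2
    have : min (1 / 2) c₀ ≤ c₀ := min_le_right _ _
    nlinarith

/-- The combinatorial data of a polygon which is `C¹`-close to `γ`. -/
structure Close (γ : ℝ → EuclideanSpace ℝ (Fin 2)) (η : ℝ) (m : ℕ)
    (v σ : ℕ → EuclideanSpace ℝ (Fin 2)) (τ : ℕ → ℝ) : Prop where
  vper : ∀ i, v (i + m) = v i
  sper : ∀ i, σ (i + m) = σ i
  tper : ∀ i, τ (i + m) = τ i + 1
  t0 : τ 0 = 0
  tmono : StrictMono τ
  v0 : v 0 = γ 0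
  vstep : ∀ i, v (i + 1) = v i + (τ (i + 1) - τ i) • σ i
  close : ∀ i, ∀ t ∈ Set.Icc (τ i) (τ (i + 1)), ‖σ i - deriv γ t‖ ≤ η

section
variable {γ : ℝ → EuclideanSpace ℝ (Fin 2)} {η : ℝ} {m : ℕ}
    {v σ : ℕ → EuclideanSpace ℝ (Fin 2)} {τ : ℕ → ℝ}

lemma Close.loc (hγ : InN γ) (H : Close γ η m v σ τ) (i : ℕ) (s t : ℝ)
    (hs : τ i ≤ s) (hst : s ≤ t) (ht : t ≤ τ (i + 1)) :
    ‖((v i + (t - τ i) • σ i) - γ t) - ((v i + (s - τ i) • σ i) - γ s)‖ ≤ η * (t - s) := by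
  have h := mvt hγ (σ i) η s t hst (fun r hr => H.close i r ⟨hs.trans hr.1, hr.2.trans ht⟩)
  have e : ((v i + (t - τ i) • σ i) - γ t) - ((v i + (s - τ i) • σ i) - γ s)
    = (t - s) • σ i - (γ t - γ s) := by module
  rw [e]
  exact h

lemma Close.vert (hγ : InN γ) (H : Close γ η m v σ τ) (i k : ℕ) :
    ‖(v (i + k) - γ (τ (i + k))) - (v i - γ (τ i))‖ ≤ η * (τ (i + k) - τ i) := by
  induction k with
  | zero => simp
  | succ k ih =>
    have h := H.loc hγ (i + k) _ _ le_rfl (H.tmono.monotone (Nat.le_succ (i + k))) le_rfl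
    rw [← H.vstep (i + k)] at h
    simp only [sub_self, zero_smul, add_zero] at h
    have e : v (i + (k + 1)) - γ (τ (i + (k + 1))) - (v i - γ (τ i)) =
      (v (i + k + 1) - γ (τ (i + k + 1)) - (v (i + k) - γ (τ (i + k)))) +
      ((v (i + k) - γ (τ (i + k))) - (v i - γ (τ i))) := by
        rw [← add_assoc]; abel
    rw [e]
    refine (norm_add_le _ _).trans ?_
    rw [← add_assoc]
    linarith

lemma Close.glob (hγ : InN γ) (H : Close γ η m v σ τ) (i j : ℕ) (hij : i < j) (s t : ℝ)
    (hs : s ∈ Set.Icc (τ i) (τ (i + 1))) (ht : t ∈ Set.Icc (τ j) (τ (j + 1))) :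
    ‖((v j + (t - τ j) • σ j) - γ t) - ((v i + (s - τ i) • σ i) - γ s)‖ ≤ η * (t - s) := by
  obtain ⟨k, rfl⟩ := Nat.exists_eq_add_of_lt hij
  have h1 := H.loc hγ i s _ hs.1 hs.2 le_rfl
  have h2 := H.loc hγ _ _ t le_rfl ht.1 ht.2
  have h3 := H.vert hγ (i + 1) k
  rw [← H.vstep i] at h1
  simp only [sub_self, zero_smul, add_zero] at h2
  have e : i + 1 + k = i + k + 1 := by ring
  rw [e] at h3
  have e2 : ((v (i + k + 1) + (t - τ (i + k + 1)) • σ (i + k + 1)) - γ t)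
      - ((v i + (s - τ i) • σ i) - γ s) =
    (v (i + k + 1) + (t - τ (i + k + 1)) • σ (i + k + 1) - γ t
      - (v (i + k + 1) - γ (τ (i + k + 1)))) +
    (v (i + k + 1) - γ (τ (i + k + 1)) - (v (i + 1) - γ (τ (i + 1)))) +
    (v (i + 1) - γ (τ (i + 1)) - (v i + (s - τ i) • σ i - γ s)) := by abel
  rw [e2]
  refine (norm_add₃_le).trans ?_
  linarith

lemma Close.tm (H : Close γ η m v σ τ) : τ m = 1 := by
  have := H.tper 0
  rw [zero_add, H.t0] at this
  linarith

lemma Close.mem_seg (H : Close γ η m v σ τ) (i : ℕ) (x : EuclideanSpace ℝ (Fin 2)) :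
    x ∈ segment ℝ (v i) (v (i + 1)) ↔
      ∃ t ∈ Set.Icc (τ i) (τ (i + 1)), x = v i + (t - τ i) • σ i := by
  have hlt : 0 < τ (i + 1) - τ i := sub_pos.2 (H.tmono (Nat.lt_succ_self i))
  rw [segment_eq_image']
  constructor
  · rintro ⟨θ, hθ, rfl⟩
    refine ⟨τ i + θ * (τ (i + 1) - τ i), ⟨?_, ?_⟩, ?_⟩
    · nlinarith [hθ.1]
    · nlinarith [hθ.2]
    · simp only [H.vstep i]
      module
  · rintro ⟨t, ht, rfl⟩
    refine ⟨(t - τ i) / (τ (i + 1) - τ i), ⟨?_, ?_⟩, ?_⟩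
    · exact div_nonneg (by linarith [ht.1]) hlt.le
    · rw [div_le_one hlt]
      linarith [ht.2]
    · simp only [H.vstep i, add_sub_cancel_left, smul_smul]
      rw [div_mul_cancel₀ _ hlt.ne']

lemma Close.simple (hγ : InN γ) (H : Close γ η m v σ τ) {c : ℝ} (hη : η < c)
    (hc : ∀ s t : ℝ, s ≤ t → t - s ≤ 1 / 2 → c * (t - s) ≤ ‖γ t - γ s‖)
    (i j : ℕ) (hij : i < j) (hjm : j < m) (x : EuclideanSpace ℝ (Fin 2))
    (hx : x ∈ segment ℝ (v i) (v (i + 1))) (hx' : x ∈ segment ℝ (v j) (v (j + 1))) :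
    (j = i + 1 ∧ x = v j) ∨ (i = 0 ∧ j + 1 = m ∧ x = v i) := by
  rw [H.mem_seg] at hx hx'
  obtain ⟨s, hs, rfl⟩ := hx
  obtain ⟨t, ht, hxt⟩ := hx'
  have h1 : τ (i + 1) ≤ τ j := H.tmono.monotone hij
  have h2 : τ (j + 1) ≤ τ m := H.tmono.monotone hjm
  have h3 : τ 0 ≤ τ i := H.tmono.monotone (Nat.zero_le i)
  have hst : s ≤ t := hs.2.trans (h1.trans ht.1)
  rcases le_total (t - s) (1 / 2) with hle | hle
  · left
    have hg := H.glob hγ i j hij s t hs ht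
    rw [← hxt] at hg
    have e : v i + (s - τ i) • σ i - γ t - (v i + (s - τ i) • σ i - γ s) = -(γ t - γ s) := by abel
    rw [e, norm_neg] at hg
    have hcc := hc s t hst hle
    have hz : t - s ≤ 0 := by
      by_contra! hpos
      nlinarith
    have e1 : s = τ (i + 1) := le_antisymm hs.2 (by linarith [ht.1])
    have e2 : τ (i + 1) = τ j := le_antisymm h1 (by linarith [ht.1])
    have e3 := H.tmono.injective e2
    refine ⟨e3.symm, ?_⟩
    rw [e1, ← H.vstep, e3]
  · right
    have hg := H.glob hγ j (i + m) (by omega) t (s + 1) ht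
      (by rw [H.tper, show i + m + 1 = (i + 1) + m by ring, H.tper]
          exact ⟨by linarith [hs.1], by linarith [hs.2]⟩)
    rw [H.vper, H.sper, H.tper, ← hxt] at hg
    have e0 : s + 1 - (τ i + 1) = s - τ i := by ring
    rw [e0] at hg
    have e : v i + (s - τ i) • σ i - γ (s + 1) - (v i + (s - τ i) • σ i - γ t)
      = -(γ (s + 1) - γ t) := by abel
    rw [e, norm_neg] at hg
    have hm := H.tm
    have h0 := H.t0
    have hts : t ≤ s + 1 := by linarith [ht.2, hs.1]
    have hcc := hc t (s + 1) hts (by linarith)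
    have hz : s + 1 - t ≤ 0 := by
      by_contra! hpos
      nlinarith
    have e1 : τ (j + 1) = τ m := le_antisymm h2 (by linarith [ht.2, hs.1])
    have e2 : τ i = τ 0 := le_antisymm (by linarith [ht.2, hs.1]) h3
    have e3 : s = τ i := le_antisymm (by linarith [ht.2, hs.1]) hs.1
    refine ⟨H.tmono.injective e2, H.tmono.injective e1, ?_⟩
    rw [e3]
    simp

lemma Close.pos (hγ : InN γ) (H : Close γ η m v σ τ) (hη : 0 ≤ η) (i : ℕ) (hi : i < m) (t : ℝ)
    (ht : t ∈ Set.Icc (τ i) (τ (i + 1))) :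
    ‖(v i + (t - τ i) • σ i) - γ t‖ ≤ η := by
  have h1 := H.loc hγ i _ t le_rfl ht.1 ht.2
  have h2 := H.vert hγ 0 i
  simp only [sub_self, zero_smul, add_zero, zero_add, H.t0, H.v0] at h1 h2
  have h3 : τ (i + 1) ≤ τ m := H.tmono.monotone hi
  rw [H.tm] at h3
  have e : (v i + (t - τ i) • σ i) - γ t =
    ((v i + (t - τ i) • σ i - γ t - (v i - γ (τ i)))) + (v i - γ (τ i) - 0) := by abel
  rw [e]
  refine (norm_add_le _ _).trans ?_
  have := ht.2
  nlinarith

lemma find_idx (τ : ℕ → ℝ) (h0 : τ 0 = 0) (k : ℕ) (t : ℝ) (ht0 : 0 ≤ t) (htk : t < τ k) :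
    ∃ i < k, t ∈ Set.Icc (τ i) (τ (i + 1)) := by
  induction k with
  | zero => linarith
  | succ k ih =>
    rcases lt_or_ge t (τ k) with h | h
    · obtain ⟨i, hi, h'⟩ := ih h
      exact ⟨i, by omega, h'⟩
    · exact ⟨k, by omega, h, htk.le⟩

lemma Close.final (hγ : InN γ) (H : Close γ η m v σ τ) {c : ℝ} (hηc : η < c)
    (hc : ∀ s t : ℝ, s ≤ t → t - s ≤ 1 / 2 → c * (t - s) ≤ ‖γ t - γ s‖)
    (hη0 : 0 < η) (ε : ℝ) (hηε : 2 * η < ε) (hm : 3 ≤ m)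
    (ρ : ℕ → ℝ) (q : ℕ → ℚ) (hρ : ∀ i, 0 < ρ i) (hσ : ∀ i, σ i = ρ i • uvec (q i * Real.pi))
    (hsum : (∑ i ∈ Finset.range m, ‖v (i + 1) - v i‖) = 1) :
      (∀ i : ℕ, v (i + m) = v i) ∧
      ∀ e : ℕ → EuclideanSpace ℝ (Fin 2),
        (∀ i : ℕ, e i = ‖v (i + 1) - v i‖⁻¹ • (v (i + 1) - v i)) →
      (∀ i : ℕ, v (i + 1) ≠ v i) ∧
      (∀ i < m, ∀ j < m, i ≠ j →
        ((i + 1) % m = j →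
          segment ℝ (v i) (v (i + 1)) ∩ segment ℝ (v j) (v (j + 1)) = {v j}) ∧
        ((j + 1) % m = i →
          segment ℝ (v i) (v (i + 1)) ∩ segment ℝ (v j) (v (j + 1)) = {v i}) ∧
        ((i + 1) % m ≠ j → (j + 1) % m ≠ i →
          segment ℝ (v i) (v (i + 1)) ∩ segment ℝ (v j) (v (j + 1)) = ∅)) ∧
      (∑ i ∈ Finset.range m, ‖v (i + 1) - v i‖) = 1 ∧
      (∀ i : ℕ, ∃ q : ℚ,
        InnerProductGeometry.angle (e i) (e (i + 1)) = (q : ℝ) * Real.pi) ∧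
      Metric.hausdorffDist (Kset γ)
        (⋃ i ∈ Finset.range m,
          ((fun p => (p, e i)) '' segment ℝ (v i) (v (i + 1)) ∪
            (fun p => (p, -e i)) '' segment ℝ (v i) (v (i + 1)))) < ε := by
  refine ⟨H.vper, fun e he => ?_⟩
  have hlt : ∀ i, 0 < τ (i + 1) - τ i := fun i => sub_pos.2 (H.tmono (Nat.lt_succ_self i))
  have hdiff : ∀ i, v (i + 1) - v i = ((τ (i + 1) - τ i) * ρ i) • uvec (q i * Real.pi) := by
    intro i
    rw [H.vstep, hσ, add_sub_cancel_left, smul_smul]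
  have hnorm : ∀ i, ‖v (i + 1) - v i‖ = (τ (i + 1) - τ i) * ρ i := by
    intro i
    have := mul_pos (hlt i) (hρ i)
    rw [hdiff, norm_smul, uvec_norm, mul_one, Real.norm_of_nonneg this.le]
  have heu : ∀ i, e i = uvec (q i * Real.pi) := by
    intro i
    have := mul_pos (hlt i) (hρ i)
    rw [he, hnorm, hdiff, smul_smul, inv_mul_cancel₀ this.ne', one_smul]
  have hne : ∀ i, v (i + 1) ≠ v i := by
    intro i h
    have h1 := hnorm i
    rw [h, sub_self, norm_zero] at h1
    have := mul_pos (hlt i) (hρ i)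
    linarith
  have hdir : ∀ i, ∀ t ∈ Set.Icc (τ i) (τ (i + 1)), ‖e i - deriv γ t‖ ≤ 2 * η := by
    intro i t ht
    have h1 := H.close i t ht
    have h2 : ‖σ i‖ = ρ i := by
      rw [hσ, norm_smul, uvec_norm, mul_one, Real.norm_of_nonneg (hρ i).le]
    have h3 := abs_norm_sub_norm_le (σ i) (deriv γ t)
    rw [h2, hγ.2] at h3
    have h4 : ‖e i - σ i‖ = |ρ i - 1| := by
      rw [heu, hσ]
      have : uvec (q i * Real.pi) - ρ i • uvec (q i * Real.pi)
        = (1 - ρ i) • uvec (q i * Real.pi) := by module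
      rw [this, norm_smul, uvec_norm, mul_one, Real.norm_eq_abs, abs_sub_comm]
    have h5 := norm_sub_le_norm_sub_add_norm_sub (e i) (σ i) (deriv γ t)
    linarith
  have hwrap : v m = v 0 := by simpa using H.vper 0
  -- adjacency
  have hadj : ∀ i < m, ∀ j < m, (i + 1) % m = j → v (i + 1) = v j := by
    intro i hi j hj h
    rcases Nat.lt_or_ge (i + 1) m with h1 | h1
    · rw [Nat.mod_eq_of_lt h1] at h
      rw [h]
    · have : i + 1 = m := by omega
      rw [this, Nat.mod_self] at h
      rw [this, hwrap, h]
  have key : ∀ i < m, ∀ j < m, i ≠ j → ∀ x ∈ segment ℝ (v i) (v (i + 1)) ∩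
      segment ℝ (v j) (v (j + 1)), ((i + 1) % m = j ∧ x = v j) ∨ ((j + 1) % m = i ∧ x = v i) := by
    intro i hi j hj hij x hx
    rcases Nat.lt_or_gt_of_ne hij with h | h
    · rcases H.simple hγ hηc hc i j h hj x hx.1 hx.2 with ⟨h1, h2⟩ | ⟨h1, h2, h3⟩
      · left
        exact ⟨by rw [← h1, Nat.mod_eq_of_lt hj], h2⟩
      · right
        exact ⟨by rw [h2, Nat.mod_self, h1], h3⟩
    · rcases H.simple hγ hηc hc j i h hi x hx.2 hx.1 with ⟨h1, h2⟩ | ⟨h1, h2, h3⟩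
      · right
        exact ⟨by rw [← h1, Nat.mod_eq_of_lt hi], h2⟩
      · left
        exact ⟨by rw [h2, Nat.mod_self, h1], h3⟩
  have hexcl : ∀ i < m, ∀ j < m, (i + 1) % m = j → (j + 1) % m = i → False := by
    intro i hi j hj h1 h2
    rcases Nat.lt_or_ge (i + 1) m with h3 | h3
    · rw [Nat.mod_eq_of_lt h3] at h1
      rcases Nat.lt_or_ge (j + 1) m with h4 | h4
      · rw [Nat.mod_eq_of_lt h4] at h2
        omega
      · have : j + 1 = m := by omega
        rw [this, Nat.mod_self] at h2
        omega
    · have : i + 1 = m := by omega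
      rw [this, Nat.mod_self] at h1
      rw [← h1, Nat.mod_eq_of_lt (by omega)] at h2
      omega
  refine ⟨hne, ?_, hsum, ?_, ?_⟩
  · intro i hi j hj hij
    refine ⟨fun h => ?_, fun h => ?_, fun h1 h2 => ?_⟩
    · apply Set.Subset.antisymm
      · intro x hx
        rcases key i hi j hj hij x hx with h1 | h1
        · exact h1.2
        · exact (hexcl i hi j hj h h1.1).elim
      · rintro x rfl
        refine ⟨?_, left_mem_segment _ _ _⟩
        rw [← hadj i hi j hj h]
        exact right_mem_segment _ _ _
    · apply Set.Subset.antisymm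
      · intro x hx
        rcases key i hi j hj hij x hx with h1 | h1
        · exact (hexcl i hi j hj h1.1 h).elim
        · exact h1.2
      · rintro x rfl
        refine ⟨left_mem_segment _ _ _, ?_⟩
        rw [← hadj j hj i hi h]
        exact right_mem_segment _ _ _
    · rw [Set.eq_empty_iff_forall_notMem]
      intro x hx
      rcases key i hi j hj hij x hx with h | h
      · exact h1 h.1
      · exact h2 h.1
  · intro i
    rw [heu, heu]
    exact uvec_angle _ _
  · refine lt_of_le_of_lt (Metric.hausdorffDist_le_of_mem_dist (r := 2 * η) (by linarith) ?_ ?_) hηε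
    · have hfr : ∀ t : ℝ, ∃ i < m, ∃ s ∈ Set.Icc (τ i) (τ (i + 1)), γ t = γ s ∧
          deriv γ t = deriv γ s := by
        intro t
        obtain ⟨i, hi, h⟩ := find_idx τ H.t0 m (t - ⌊t⌋) (by linarith [Int.floor_le t])
          (by rw [H.tm]; linarith [Int.lt_floor_add_one t])
        refine ⟨i, hi, _, h, ?_, ?_⟩
        · simpa using (hγ.1.2.sub_int_mul_eq (x := t) ⌊t⌋).symm
        · simpa using ((deriv_per hγ).sub_int_mul_eq (x := t) ⌊t⌋).symm
      rintro x (⟨t, rfl⟩ | ⟨t, rfl⟩)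
      · obtain ⟨i, hi, s, hs, h1, h2⟩ := hfr t
        rw [h1, h2]
        refine ⟨(v i + (s - τ i) • σ i, e i), ?_, ?_⟩
        · simp only [Set.mem_iUnion]
          exact ⟨i, Finset.mem_range.2 hi, Or.inl ⟨_, (H.mem_seg i _).2 ⟨s, hs, rfl⟩, rfl⟩⟩
        · rw [dist_comm, Prod.dist_eq]
          refine max_le ?_ ?_
          · rw [dist_eq_norm]
            linarith [H.pos hγ hη0.le i hi s hs]
          · rw [dist_eq_norm]
            exact hdir i s hs
      · obtain ⟨i, hi, s, hs, h1, h2⟩ := hfr t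
        rw [h1, h2]
        refine ⟨(v i + (s - τ i) • σ i, -e i), ?_, ?_⟩
        · simp only [Set.mem_iUnion]
          exact ⟨i, Finset.mem_range.2 hi, Or.inr ⟨_, (H.mem_seg i _).2 ⟨s, hs, rfl⟩, rfl⟩⟩
        · rw [dist_comm, Prod.dist_eq]
          refine max_le ?_ ?_
          · rw [dist_eq_norm]
            linarith [H.pos hγ hη0.le i hi s hs]
          · rw [dist_neg_neg, dist_eq_norm]
            exact hdir i s hs
    · intro x hx
      simp only [Set.mem_iUnion] at hx
      obtain ⟨i, hi, ⟨p, hp, rfl⟩ | ⟨p, hp, rfl⟩⟩ := hx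
      · rw [Finset.mem_range] at hi
        obtain ⟨t, ht, rfl⟩ := (H.mem_seg i _).1 hp
        refine ⟨(γ t, deriv γ t), Or.inl ⟨t, rfl⟩, ?_⟩
        rw [Prod.dist_eq]
        refine max_le ?_ ?_
        · rw [dist_eq_norm]
          linarith [H.pos hγ hη0.le i hi t ht]
        · rw [dist_eq_norm]
          exact hdir i t ht
      · rw [Finset.mem_range] at hi
        obtain ⟨t, ht, rfl⟩ := (H.mem_seg i _).1 hp
        refine ⟨(γ t, -deriv γ t), Or.inr ⟨t, rfl⟩, ?_⟩
        rw [Prod.dist_eq]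
        refine max_le ?_ ?_
        · rw [dist_eq_norm]
          linarith [H.pos hγ hη0.le i hi t ht]
        · rw [dist_neg_neg, dist_eq_norm]
          exact hdir i t ht

end

lemma Close.sum_bound {γ : ℝ → EuclideanSpace ℝ (Fin 2)} {η : ℝ} {m : ℕ}
    {v σ : ℕ → EuclideanSpace ℝ (Fin 2)} {τ : ℕ → ℝ} (hγ : InN γ) (H : Close γ η m v σ τ) :
    |(∑ i ∈ Finset.range m, ‖v (i + 1) - v i‖) - 1| ≤ η := by
  have hs : ∑ i ∈ Finset.range m, (τ (i + 1) - τ i) = 1 := by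
    rw [Finset.sum_range_sub, H.tm, H.t0, sub_zero]
  have hb : ∀ i, |‖v (i + 1) - v i‖ - (τ (i + 1) - τ i)| ≤ η * (τ (i + 1) - τ i) := by
    intro i
    have hlt : 0 < τ (i + 1) - τ i := sub_pos.2 (H.tmono (Nat.lt_succ_self i))
    have h1 := H.close i (τ i) ⟨le_rfl, by linarith⟩
    have h3 := abs_norm_sub_norm_le (σ i) (deriv γ (τ i))
    rw [hγ.2] at h3
    rw [H.vstep, add_sub_cancel_left, norm_smul, Real.norm_of_nonneg hlt.le]
    have : (τ (i + 1) - τ i) * ‖σ i‖ - (τ (i + 1) - τ i) = (‖σ i‖ - 1) * (τ (i + 1) - τ i) := by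
      ring
    rw [this, abs_mul, abs_of_pos hlt]
    exact mul_le_mul_of_nonneg_right (h3.trans h1) hlt.le
  calc |(∑ i ∈ Finset.range m, ‖v (i + 1) - v i‖) - 1|
      = |∑ i ∈ Finset.range m, (‖v (i + 1) - v i‖ - (τ (i + 1) - τ i))| := by
        rw [Finset.sum_sub_distrib, hs]
    _ ≤ ∑ i ∈ Finset.range m, |‖v (i + 1) - v i‖ - (τ (i + 1) - τ i)| :=
        Finset.abs_sum_le_sum_abs _ _
    _ ≤ ∑ i ∈ Finset.range m, η * (τ (i + 1) - τ i) := Finset.sum_le_sum fun i _ => hb i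
    _ = η := by rw [← Finset.mul_sum, hs, mul_one]

lemma Close.scale {γ : ℝ → EuclideanSpace ℝ (Fin 2)} {η : ℝ} {m : ℕ}
    {v σ : ℕ → EuclideanSpace ℝ (Fin 2)} {τ : ℕ → ℝ} (hγ : InN γ) (H : Close γ η m v σ τ)
    (hη : η ≤ 1 / 2) : ∃ (v' : ℕ → EuclideanSpace ℝ (Fin 2)) (l : ℝ), 0 < l ∧
      Close γ (4 * η) m v' (fun i => l • σ i) τ ∧
      (∑ i ∈ Finset.range m, ‖v' (i + 1) - v' i‖) = 1 := by
  have hL := H.sum_bound hγ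
  set L := ∑ i ∈ Finset.range m, ‖v (i + 1) - v i‖ with hLdef
  have hL' := abs_le.1 hL
  have hLpos : 0 < L := by linarith
  have hl : |L⁻¹ - 1| ≤ 2 * η := by
    have : L⁻¹ - 1 = -(L - 1) / L := by field_simp; ring
    rw [this, abs_div, abs_neg, abs_of_pos hLpos, div_le_iff₀ hLpos]
    have : 0 ≤ η := (abs_nonneg _).trans hL
    nlinarith
  refine ⟨fun i => γ 0 + L⁻¹ • (v i - γ 0), L⁻¹, inv_pos.2 hLpos, ⟨?_, ?_, H.tper, H.t0, H.tmono,
    ?_, ?_, ?_⟩, ?_⟩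
  · intro i
    simp only [H.vper]
  · intro i
    simp only [H.sper]
  · simp [H.v0]
  · intro i
    simp only [H.vstep i]
    module
  · intro i t ht
    have h1 := H.close i t ht
    have h2 : ‖σ i‖ ≤ 1 + η := by
      have := norm_sub_norm_le (σ i) (deriv γ t)
      rw [hγ.2] at this
      linarith
    have e : L⁻¹ • σ i - deriv γ t = (L⁻¹ - 1) • σ i + (σ i - deriv γ t) := by module
    rw [e]
    refine (norm_add_le _ _).trans ?_
    rw [norm_smul, Real.norm_eq_abs]
    have h3 : |L⁻¹ - 1| * ‖σ i‖ ≤ (2 * η) * (3 / 2) :=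
      mul_le_mul hl (by linarith) (norm_nonneg _) ((abs_nonneg _).trans hl)
    linarith
  · have : ∀ i, ‖(γ 0 + L⁻¹ • (v (i + 1) - γ 0)) - (γ 0 + L⁻¹ • (v i - γ 0))‖
        = L⁻¹ * ‖v (i + 1) - v i‖ := by
      intro i
      have e : (γ 0 + L⁻¹ • (v (i + 1) - γ 0)) - (γ 0 + L⁻¹ • (v i - γ 0))
        = L⁻¹ • (v (i + 1) - v i) := by module
      rw [e, norm_smul, Real.norm_of_nonneg (inv_pos.2 hLpos).le]
    simp only [this]
    rw [← Finset.mul_sum, ← hLdef, inv_mul_cancel₀ hLpos.ne']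

lemma near_aux (κ N a b : ℝ) (ha : 0 < a) (hb : 0 < b) (hN : 0 ≤ N) (hκ : κ ≤ 1 / 2)
    (u u' w g : EuclideanSpace ℝ (Fin 2)) (hu : ‖u‖ = 1) (hg : ‖g‖ = 1)
    (hw : w = a • u + b • u') (huu : ‖u - u'‖ ≤ κ) (hwg : ‖N • w - g‖ ≤ κ) :
    ‖(N * (a + b)) • u - g‖ ≤ 5 * κ ∧ ‖(N * (a + b)) • u' - g‖ ≤ 5 * κ := by
  have e1 : (a + b) • u = w + b • (u - u') := by rw [hw]; module
  have h1 : a + b ≤ ‖w‖ + b * κ := by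
    have h := congrArg norm e1
    rw [norm_smul, hu, Real.norm_of_nonneg (by linarith), mul_one] at h
    rw [h]
    refine (norm_add_le _ _).trans ?_
    rw [norm_smul, Real.norm_of_nonneg hb.le]
    gcongr
  have h2 : a + b ≤ 2 * ‖w‖ := by nlinarith
  have h3 : N * ‖w‖ ≤ 2 := by
    have h := norm_sub_norm_le (N • w) g
    rw [norm_smul, hg, Real.norm_of_nonneg hN] at h
    linarith
  have h4 : N * (a + b) ≤ 4 := by nlinarith
  have hNa : 0 ≤ N * a := by positivity
  have hNb : 0 ≤ N * b := by positivity
  constructor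
  · have e : (N * (a + b)) • u - g = (N * b) • (u - u') + (N • w - g) := by rw [hw]; module
    rw [e]
    refine (norm_add_le _ _).trans ?_
    rw [norm_smul, Real.norm_of_nonneg hNb]
    have : N * b * ‖u - u'‖ ≤ 4 * κ :=
      mul_le_mul (by linarith) huu (norm_nonneg _) (by norm_num)
    linarith
  · have e : (N * (a + b)) • u' - g = (N • w - g) - (N * a) • (u - u') := by rw [hw]; module
    rw [e]
    refine (norm_sub_le _ _).trans ?_
    rw [norm_smul, Real.norm_of_nonneg hNa]
    have : N * a * ‖u - u'‖ ≤ 4 * κ :=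
      mul_le_mul (by linarith) huu (norm_nonneg _) (by norm_num)
    linarith

lemma construct {γ : ℝ → EuclideanSpace ℝ (Fin 2)} (hγ : InN γ) (κ : ℝ) (hκ0 : 0 < κ)
    (hκ : κ ≤ 1 / 2) : ∃ (m : ℕ) (v : ℕ → EuclideanSpace ℝ (Fin 2)) (τ : ℕ → ℝ) (ρ : ℕ → ℝ)
      (q : ℕ → ℚ), 3 ≤ m ∧ (∀ i, 0 < ρ i) ∧
      Close γ (5 * κ) m v (fun i => ρ i • uvec (q i * Real.pi)) τ := by
  obtain ⟨δ, hδ, hu⟩ := deriv_unif hγ κ hκ0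
  have hdec : ∀ w : EuclideanSpace ℝ (Fin 2), ∃ (a b : ℝ) (p q : ℚ), w ≠ 0 → (0 < a ∧ 0 < b ∧
      w = a • uvec (p * Real.pi) + b • uvec (q * Real.pi) ∧
      ‖uvec (p * Real.pi) - uvec (q * Real.pi)‖ ≤ κ) := by
    intro w
    by_cases h : w = 0
    · exact ⟨0, 0, 0, 0, fun h' => (h' h).elim⟩
    · obtain ⟨a, b, p, q, h'⟩ := decomp κ hκ0 w h
      exact ⟨a, b, p, q, fun _ => h'⟩
  choose A B Q R hdec using hdec
  obtain ⟨n₀, hn₀⟩ := exists_nat_gt (1 / δ)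
  set n := n₀ + 2 with hn
  have hnpos : (0 : ℝ) < n := by positivity
  have hnδ : 1 / (n : ℝ) ≤ δ := by
    rw [div_le_iff₀ hnpos]
    rw [div_lt_iff₀ hδ] at hn₀
    have : (n : ℝ) = n₀ + 2 := by rw [hn]; push_cast; ring
    rw [this]
    nlinarith
  set T : ℕ → ℝ := fun j => j / n with hT
  have hT1 : ∀ j, T (j + 1) = T j + 1 / n := by
    intro j
    simp only [hT]
    push_cast
    ring
  set w : ℕ → EuclideanSpace ℝ (Fin 2) := fun j => γ (T (j + 1)) - γ (T j) with hw
  have hTn : ∀ j, T (j + n) = T j + 1 := by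
    intro j
    simp only [hT]
    push_cast
    field_simp
  have hγT : ∀ j, γ (T (j + n)) = γ (T j) := by
    intro j
    rw [hTn, hγ.1.2]
  have hwn : ∀ j, w (j + n) = w j := by
    intro j
    simp only [hw]
    rw [show j + n + 1 = (j + 1) + n by ring, hγT, hγT]
  have hwg : ∀ j, ∀ t ∈ Set.Icc (T j) (T (j + 1)), ‖(n : ℝ) • w j - deriv γ t‖ ≤ κ := by
    intro j t ht
    have h0 : 0 < 1 / (n : ℝ) := by positivity
    have h := mvt hγ (deriv γ t) κ (T j) (T (j + 1)) (by linarith [hT1 j]) (by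
      intro r hr
      apply hu
      rw [abs_le]
      constructor <;> linarith [hr.1, hr.2, ht.1, ht.2, hT1 j])
    have e : (n : ℝ) • w j - deriv γ t
        = -((n : ℝ) • ((T (j + 1) - T j) • deriv γ t - (γ (T (j + 1)) - γ (T j)))) := by
      have e1 : (n : ℝ) * (T (j + 1) - T j) = 1 := by
        rw [hT1 j, add_sub_cancel_left, mul_one_div_cancel hnpos.ne']
      have e2 : w j = γ (T (j + 1)) - γ (T j) := rfl
      rw [← e2, smul_sub (n : ℝ) _ (w j), smul_smul, e1, one_smul]
      abel
    rw [e, norm_neg, norm_smul, Real.norm_of_nonneg hnpos.le]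
    have h2 : κ * (T (j + 1) - T j) = κ / n := by rw [hT1 j]; ring
    rw [h2, le_div_iff₀ hnpos] at h
    linarith
  have hw0 : ∀ j, w j ≠ 0 := by
    intro j h
    have h0 : 0 < 1 / (n : ℝ) := by positivity
    have h1 := hwg j (T j) ⟨le_rfl, by linarith [hT1 j]⟩
    rw [h, smul_zero, zero_sub, norm_neg, hγ.2] at h1
    linarith
  have hA : ∀ j, 0 < A (w j) := fun j => (hdec _ (hw0 j)).1
  have hB : ∀ j, 0 < B (w j) := fun j => (hdec _ (hw0 j)).2.1
  have hWW : ∀ j, w j = A (w j) • uvec (Q (w j) * Real.pi) + B (w j) • uvec (R (w j) * Real.pi) :=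
    fun j => (hdec _ (hw0 j)).2.2.1
  have hUU := fun j => (hdec _ (hw0 j)).2.2.2
  set S : ℕ → ℝ := fun j => A (w j) / (n * (A (w j) + B (w j))) with hS
  have hS0 : ∀ j, 0 < S j := by
    intro j
    have := hA j
    have := hB j
    simp only [hS]
    positivity
  have hS1 : ∀ j, 1 / n - S j = B (w j) / (n * (A (w j) + B (w j))) := by
    intro j
    have := hA j
    have := hB j
    simp only [hS]
    field_simp
    ring
  have hS2 : ∀ j, S j < 1 / n := by
    intro j
    rw [← sub_pos, hS1 j]
    have := hA j
    have := hB j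
    positivity
  set τ : ℕ → ℝ := fun k => if k % 2 = 0 then T (k / 2) else T (k / 2) + S (k / 2) with hτ
  set v : ℕ → EuclideanSpace ℝ (Fin 2) := fun k => if k % 2 = 0 then γ (T (k / 2)) else
    γ (T (k / 2)) + A (w (k / 2)) • uvec (Q (w (k / 2)) * Real.pi) with hv
  set ρ : ℕ → ℝ := fun k => n * (A (w (k / 2)) + B (w (k / 2))) with hρ
  set q : ℕ → ℚ := fun k => if k % 2 = 0 then Q (w (k / 2)) else R (w (k / 2)) with hq
  have p1 : ∀ j, (2 * j) % 2 = 0 := by intro j; omega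
  have p2 : ∀ j, (2 * j) / 2 = j := by intro j; omega
  have p3 : ∀ j, ¬ (2 * j + 1) % 2 = 0 := by intro j; omega
  have p4 : ∀ j, (2 * j + 1) / 2 = j := by intro j; omega
  have p5 : ∀ j, 2 * j + 1 + 1 = 2 * (j + 1) := by intro j; ring
  have τe : ∀ j, τ (2 * j) = T j := by intro j; simp only [hτ]; rw [if_pos (p1 j), p2]
  have τo : ∀ j, τ (2 * j + 1) = T j + S j := by
    intro j; simp only [hτ]; rw [if_neg (p3 j), p4]
  have ve : ∀ j, v (2 * j) = γ (T j) := by intro j; simp only [hv]; rw [if_pos (p1 j), p2]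
  have vo : ∀ j, v (2 * j + 1) = γ (T j) + A (w j) • uvec (Q (w j) * Real.pi) := by
    intro j; simp only [hv]; rw [if_neg (p3 j), p4]
  have ρe : ∀ j, ρ (2 * j) = n * (A (w j) + B (w j)) := by intro j; simp only [hρ]; rw [p2]
  have ρo : ∀ j, ρ (2 * j + 1) = n * (A (w j) + B (w j)) := by intro j; simp only [hρ]; rw [p4]
  have qe : ∀ j, q (2 * j) = Q (w j) := by intro j; simp only [hq]; rw [if_pos (p1 j), p2]
  have qo : ∀ j, q (2 * j + 1) = R (w j) := by
    intro j; simp only [hq]; rw [if_neg (p3 j), p4]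
  clear_value τ v ρ q
  have par : ∀ k : ℕ, ∃ j, k = 2 * j ∨ k = 2 * j + 1 := fun k => ⟨k / 2, by omega⟩
  have Sn : ∀ j, S (j + n) = S j := by intro j; simp only [hS, hwn]
  have m1 : ∀ j, 2 * j + 2 * n = 2 * (j + n) := by intro j; ring
  have m2 : ∀ j, 2 * j + 1 + 2 * n = 2 * (j + n) + 1 := by intro j; ring
  refine ⟨2 * n, v, τ, ρ, q, by omega, ?_, ⟨?_, ?_, ?_, ?_, ?_, ?_, ?_, ?_⟩⟩
  · intro k
    obtain ⟨j, rfl | rfl⟩ := par k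
    · rw [ρe]
      have := hA j
      have := hB j
      positivity
    · rw [ρo]
      have := hA j
      have := hB j
      positivity
  · intro k
    obtain ⟨j, rfl | rfl⟩ := par k
    · rw [m1, ve, ve, hγT]
    · rw [m2, vo, vo, hγT, hwn]
  · intro k
    obtain ⟨j, rfl | rfl⟩ := par k
    · simp only [m1, ρe, qe, hwn]
    · simp only [m2, ρo, qo, hwn]
  · intro k
    obtain ⟨j, rfl | rfl⟩ := par k
    · rw [m1, τe, τe, hTn]
    · rw [m2, τo, τo, hTn, Sn]
      ring
  · have := τe 0
    simpa [hT] using this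
  · apply strictMono_nat_of_lt_succ
    intro k
    obtain ⟨j, rfl | rfl⟩ := par k
    · rw [τe, τo]
      linarith [hS0 j]
    · rw [p5, τe, τo, hT1]
      linarith [hS2 j]
  · have := ve 0
    simpa [hT] using this
  · intro k
    obtain ⟨j, rfl | rfl⟩ := par k
    · have h1 := hA j
      have h2 := hB j
      simp only [τe, τo, ve, vo, ρe, qe]
      rw [add_sub_cancel_left, smul_smul]
      congr 2
      simp only [hS]
      field_simp
    · have h1 := hA j
      have h2 := hB j
      simp only [p5, τe, τo, ve, vo, ρo, qo]
      rw [smul_smul]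
      have e : (T (j + 1) - (T j + S j)) * (n * (A (w j) + B (w j))) = B (w j) := by
        have : T (j + 1) - (T j + S j) = 1 / n - S j := by rw [hT1]; ring
        rw [this, hS1]
        field_simp
      rw [e, add_assoc, ← hWW j]
      simp only [hw]
      abel
  · intro k t ht
    obtain ⟨j, rfl | rfl⟩ := par k
    · simp only [τe, τo, ρe, qe] at ht ⊢
      exact (near_aux κ n _ _ (hA j) (hB j) hnpos.le hκ _ _ (w j) (deriv γ t)
        (uvec_norm _) (hγ.2 t) (hWW j) (hUU j)
        (hwg j t ⟨ht.1, by linarith [ht.2, hS2 j, hT1 j]⟩)).1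
    · simp only [p5, τe, τo, ρo, qo] at ht ⊢
      exact (near_aux κ n _ _ (hA j) (hB j) hnpos.le hκ _ _ (w j) (deriv γ t)
        (uvec_norm _) (hγ.2 t) (hWW j) (hUU j)
        (hwg j t ⟨by linarith [ht.1, hS0 j], ht.2⟩)).2

/-- Rational simple polygons of perimeter 1 are dense among `C¹` billiard tables
(Lemma 4 of the paper): given an injective unit-speed `C¹` loop `γ` and `ε > 0`,
there is a simple closed polygon (vertices `v 0, …, v (m-1)`, indices mod `m`, `m ≥ 3`)
of perimeter 1, all of whose angles are rational multiples of `π`, whose unitary tangent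
bundle is `ε`-close to `K(γ)` in the Hausdorff distance. -/
theorem stmt12 (γ : ℝ → EuclideanSpace ℝ (Fin 2)) (hγ : InN γ) (hinj : InjLoop γ)
    (ε : ℝ) (hε : 0 < ε) :
    ∃ (m : ℕ) (v : ℕ → EuclideanSpace ℝ (Fin 2)), 3 ≤ m ∧
      -- indices are taken modulo `m`
      (∀ i : ℕ, v (i + m) = v i) ∧
      -- unit edge directions
      ∀ e : ℕ → EuclideanSpace ℝ (Fin 2),
        (∀ i : ℕ, e i = ‖v (i + 1) - v i‖⁻¹ • (v (i + 1) - v i)) →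
      -- (i) consecutive vertices are distinct and the polygon is simple
      (∀ i : ℕ, v (i + 1) ≠ v i) ∧
      (∀ i < m, ∀ j < m, i ≠ j →
        ((i + 1) % m = j →
          segment ℝ (v i) (v (i + 1)) ∩ segment ℝ (v j) (v (j + 1)) = {v j}) ∧
        ((j + 1) % m = i →
          segment ℝ (v i) (v (i + 1)) ∩ segment ℝ (v j) (v (j + 1)) = {v i}) ∧
        ((i + 1) % m ≠ j → (j + 1) % m ≠ i →
          segment ℝ (v i) (v (i + 1)) ∩ segment ℝ (v j) (v (j + 1)) = ∅)) ∧
      -- (ii) the perimeter equals 1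
      (∑ i ∈ Finset.range m, ‖v (i + 1) - v i‖) = 1 ∧
      -- (iii) all angles are rational multiples of π
      (∀ i : ℕ, ∃ q : ℚ,
        InnerProductGeometry.angle (e i) (e (i + 1)) = (q : ℝ) * Real.pi) ∧
      -- (iv) the unitary tangent bundles are ε-close in the Hausdorff distance
      Metric.hausdorffDist (Kset γ)
        (⋃ i ∈ Finset.range m,
          ((fun p => (p, e i)) '' segment ℝ (v i) (v (i + 1)) ∪
            (fun p => (p, -e i)) '' segment ℝ (v i) (v (i + 1)))) < ε := by
  obtain ⟨c, hc0, hc⟩ := bilip hγ hinj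
  set κ := min (1 / 10) (min (c / 40) (ε / 80)) with hκ
  have hκ0 : 0 < κ := by positivity
  have h1 : κ ≤ 1 / 10 := min_le_left _ _
  have h2 : κ ≤ c / 40 := (min_le_right _ _).trans (min_le_left _ _)
  have h3 : κ ≤ ε / 80 := (min_le_right _ _).trans (min_le_right _ _)
  obtain ⟨m, v, τ, ρ, q, hm, hρ, H⟩ := construct hγ κ hκ0 (by linarith)
  obtain ⟨v', l, hl, H', hsum⟩ := H.scale hγ (by linarith)
  exact ⟨m, v', hm, H'.final hγ (by linarith) hc (by linarith) ε (by linarith) hm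
    (fun i => l * ρ i) q (fun i => mul_pos hl (hρ i)) (fun i => smul_smul _ _ _) hsum⟩
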